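/- Let $A$ and $B$ be finite alphabets, where $A$ has at least two letters. An infinite word $w$ is LSP if every finite word $u$ for which there are two distinct letters $x\neq y$ such that $xu$ and $yu$ are both factors of $w$ is a prefix of $w$. Let $f : A^* \to B^*$ be a nonerasing morphism that preserves the LSP property for infinite words (that is, $f(w)$ is LSP for every infinite LSP word $w$ over $A$), and assume that for all distinct letters $a$ and $b$ of $A$, the words $f(a)$ and $f(b)$ do not have the same primitive root (the primitive root of a nonempty word $w$ is the shortest word $u$ with $w = u^k$ for some $k \ge 1$). Then there are an integer $n \ge 0$, R-bLSP morphisms $g_1, \dots, g_n$ over $B$ and a morphism $\nu : A^* \to B^*$ in $\mathcal{U}(A,B)$ such that $$f = g_1 \circ g_2 \circ \cdots \circ g_n \circ \nu ,$$ where in this composition all letters occurring in the images of $g_{i+1}$ belong to the domain alphabet of $g_i$ for $1 \le i < n$, and, if $n\ge 1$, all letters occurring in the images of $\nu$ belong to the domain alphabet of $g_n$. Here an endomorphism $g$ of $B^*$ is bLSP if there is a letter $\alpha$ with $g(\alpha) = \alpha$ and for every letter $\beta \neq \alpha$ there is a letter $\gamma$ with $g(\beta) = g(\gamma)\beta$;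 an R-bLSP morphism over $B$ is the restriction of a bLSP endomorphism of $B^*$ to a subalphabet of $B$ (its domain alphabet); and $\mathcal{U}(A,B)$ is the set of nonerasing morphisms $\nu : A^* \to B^*$ such that every letter of $B$ occurs at most once in total in the images $\nu(a)$, $a \in A$. -/

import Mathlib

section LSPDefs

variable {A : Type*} {B : Type*}

/-- `u` is a prefix of the infinite word `w`. -/
def IsPrefixI (u : List A) (w : ℕ → A) : Prop :=
  ∀ (i : ℕ) (h : i < u.length), u.get ⟨i, h⟩ = w i

/-- `u` is a factor of the infinite word `w`. -/
def IsFactorI (u : List A) (w : ℕ → A) : Prop :=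
  ∃ k : ℕ, ∀ (i : ℕ) (h : i < u.length), u.get ⟨i, h⟩ = w (k + i)

/-- `u` is a left special factor of the infinite word `w`. -/
def LeftSpecialI (u : List A) (w : ℕ → A) : Prop :=
  ∃ a b : A, a ≠ b ∧ IsFactorI (a :: u) w ∧ IsFactorI (b :: u) w

/-- An infinite word is LSP if all its left special factors are prefixes of it. -/
def IsLSP (w : ℕ → A) : Prop :=
  ∀ u : List A, LeftSpecialI u w → IsPrefixI u w

/-- Application of a morphism (given by its images of letters) to a finite word. -/
def applyM (f : A → List B) (u : List A) : List B := (u.map f).flatten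

/-- The prefix of length `n` of an infinite word. -/
def infPrefix (w : ℕ → A) (n : ℕ) : List A := List.ofFn (fun i : Fin n => w i)

/-- `x` is the image of the infinite word `w` under the morphism `f`
(for a nonerasing `f` this determines `x`). -/
def InfImage (f : A → List B) (w : ℕ → A) (x : ℕ → B) : Prop :=
  ∀ n : ℕ, IsPrefixI (applyM f (infPrefix w n)) x

/-- A morphism is nonerasing if images of letters are nonempty. -/
def Nonerasing (f : A → List B) : Prop := ∀ a : A, f a ≠ []

/-- `f` preserves the LSP property for infinite words. -/
def PreservesLSP (f : A → List B) : Prop :=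
  ∀ (w : ℕ → A) (x : ℕ → B), IsLSP w → InfImage f w x → IsLSP x

/-- `f` is a basic LSP (bLSP) endomorphism. -/
def IsBLSP (f : A → List A) : Prop :=
  ∃ α : A, f α = [α] ∧ ∀ β : A, β ≠ α → ∃ γ : A, f β = f γ ++ [β]

/-- `f` is an R-bLSP morphism with domain alphabet `D`: the restriction to `D` of a
bLSP morphism `g`. Letters outside the domain alphabet are sent to `[]`; since images of
letters under a bLSP morphism are nonempty, `D` is exactly `{x | f x ≠ []}`. -/
def IsRBLSPOn (D : Set A) (f : A → List A) : Prop :=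
  (∀ x : A, x ∈ D ↔ f x ≠ []) ∧ ∃ g : A → List A, IsBLSP g ∧ ∀ x ∈ D, f x = g x

/-- `f ∈ U(A,B)`: nonerasing and each letter of `B` occurs at most once in total
among the images of letters. -/
def InU [Fintype A] [DecidableEq B] (f : A → List B) : Prop :=
  Nonerasing f ∧ ∀ b : B, (∑ a : A, (f a).count b) ≤ 1

/-- `u^k`. -/
def listPow (u : List B) (k : ℕ) : List B := (List.replicate k u).flatten

/-- `r` is the primitive root of `w`. -/
def IsPrimRoot (r w : List B) : Prop :=
  (∃ k : ℕ, 0 < k ∧ w = listPow r k) ∧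
  ∀ (v : List B) (k : ℕ), 0 < k → w = listPow v k → r.length ≤ v.length

/-- Compatibility of a chain of R-bLSP morphisms `[g_1, …, g_n]` (composition
`g_1 ∘ ⋯ ∘ g_n`): every letter produced by `g_{i+1}` lies in the domain alphabet of `g_i`. -/
def CompatChain (L : List (B → List B)) : Prop :=
  List.IsChain (fun g h => ∀ x y, y ∈ h x → g y ≠ []) L

end LSPDefs

section WordBasics

variable {A B C : Type*}

theorem applyM_cons (f : A → List B) (a : A) (u : List A) :
    applyM f (a :: u) = f a ++ applyM f u := by simp [applyM]

theorem applyM_append (f : A → List B) (u v : List A) :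
    applyM f (u ++ v) = applyM f u ++ applyM f v := by simp [applyM]

theorem applyM_nil (f : A → List B) : applyM f [] = [] := rfl

theorem applyM_singleton (f : A → List B) (a : A) : applyM f [a] = f a := by simp [applyM]

theorem applyM_applyM (g : B → List C) (h : A → List B) (u : List A) :
    applyM g (applyM h u) = applyM (fun a => applyM g (h a)) u := by
  induction u with
  | nil => rfl
  | cons a u ih => rw [applyM_cons, applyM_append, ih, applyM_cons]

theorem applyM_prefix (f : A → List B) {u v : List A} (h : u <+: v) :
    applyM f u <+: applyM f v := by
  obtain ⟨t, rfl⟩ := h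
  rw [applyM_append]
  exact List.prefix_append _ _

theorem length_le_length_applyM {f : A → List B} (hf : Nonerasing f) (u : List A) :
    u.length ≤ (applyM f u).length := by
  induction u with
  | nil => simp
  | cons a u ih =>
    have := List.length_pos_iff.mpr (hf a)
    rw [applyM_cons, List.length_append, List.length_cons]
    omega

theorem infPrefix_length (w : ℕ → A) (n : ℕ) : (infPrefix w n).length = n := by
  simp [infPrefix]

theorem infPrefix_getElem (w : ℕ → A) (n i : ℕ) (h : i < (infPrefix w n).length) :
    (infPrefix w n)[i] = w i := by
  simp [infPrefix]

theorem isPrefixI_iff {u : List A} {w : ℕ → A} :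
    IsPrefixI u w ↔ u = infPrefix w u.length := by
  constructor
  · intro h
    refine List.ext_getElem (infPrefix_length _ _).symm fun i h₁ h₂ => ?_
    rw [infPrefix_getElem]
    exact h i h₁
  · intro h i hi
    have : ∀ (v : List A), u = v → ∀ (hv : i < v.length), u[i] = v[i] := by
      rintro v rfl _
      rfl
    rw [List.get_eq_getElem, this _ h (by rwa [infPrefix_length]), infPrefix_getElem]

theorem infPrefix_isPrefixI (w : ℕ → A) (n : ℕ) : IsPrefixI (infPrefix w n) w := by
  intro i h
  rw [List.get_eq_getElem, infPrefix_getElem]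

theorem infPrefix_add (w : ℕ → A) (m n : ℕ) :
    infPrefix w (m + n) = infPrefix w m ++ infPrefix (fun i => w (m + i)) n := by
  simp [infPrefix, List.ofFn_add]

theorem infPrefix_prefix (w : ℕ → A) {m n : ℕ} (h : m ≤ n) : infPrefix w m <+: infPrefix w n := by
  obtain ⟨k, rfl⟩ := Nat.exists_eq_add_of_le h
  rw [infPrefix_add]
  exact List.prefix_append _ _

theorem IsPrefixI.of_prefix {u v : List A} {w : ℕ → A} (hv : IsPrefixI v w) (h : u <+: v) :
    IsPrefixI u w := by
  intro i hi
  rw [← hv i (hi.trans_le h.length_le)]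
  exact h.getElem hi

theorem IsPrefixI.prefix_of_length_le {u v : List A} {w : ℕ → A} (hu : IsPrefixI u w)
    (hv : IsPrefixI v w) (h : u.length ≤ v.length) : u <+: v := by
  rw [isPrefixI_iff.mp hu, isPrefixI_iff.mp hv]
  exact infPrefix_prefix w h

theorem IsPrefixI.isFactorI {s u t : List A} {w : ℕ → A} (h : IsPrefixI (s ++ u ++ t) w) :
    IsFactorI u w := by
  refine ⟨s.length, fun i hi => ?_⟩
  rw [← h (s.length + i) (by simp; omega)]
  simp [hi]

/-- The LSP property in terms of positions: two occurrences of a word preceded by different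
letters force that word to be a prefix. -/
theorem isLSP_iff {w : ℕ → A} :
    IsLSP w ↔ ∀ i j n, w i ≠ w j → (∀ t < n, w (i + 1 + t) = w (j + 1 + t)) →
      ∀ t < n, w t = w (i + 1 + t) := by
  constructor
  · intro h i j n hij hfac t ht
    have key : ∀ k, (∀ t < n, w (i + 1 + t) = w (k + 1 + t)) →
        IsFactorI (w k :: infPrefix (fun t => w (i + 1 + t)) n) w := by
      intro k hk
      refine ⟨k, fun s hs => ?_⟩
      rw [List.get_eq_getElem]
      cases s with
      | zero => rfl
      | succ s =>
        have hs' : s < n := by simpa [infPrefix_length] using hs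
        rw [List.getElem_cons_succ, infPrefix_getElem, hk s hs']
        congr 1
        omega
    have := h (infPrefix (fun t => w (i + 1 + t)) n)
      ⟨w i, w j, hij, key i (fun _ _ => rfl), key j hfac⟩ t (by rwa [infPrefix_length])
    rw [List.get_eq_getElem, infPrefix_getElem] at this
    exact this.symm
  · rintro h u ⟨a, b, hab, ⟨i, hi⟩, ⟨j, hj⟩⟩ t ht
    have h₁ : a = w i := hi 0 (by simp)
    have h₂ : b = w j := hj 0 (by simp)
    have e₁ : ∀ (s : ℕ) (hs : s < u.length), u[s] = w (i + 1 + s) := by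
      intro s hs
      have := hi (s + 1) (by simpa using hs)
      rw [List.get_eq_getElem, List.getElem_cons_succ] at this
      rw [this]
      congr 1
      omega
    have e₂ : ∀ (s : ℕ) (hs : s < u.length), u[s] = w (j + 1 + s) := by
      intro s hs
      have := hj (s + 1) (by simpa using hs)
      rw [List.get_eq_getElem, List.getElem_cons_succ] at this
      rw [this]
      congr 1
      omega
    rw [h i j u.length (h₁ ▸ h₂ ▸ hab) (fun s hs => (e₁ s hs).symm.trans (e₂ s hs)) t ht]
    exact e₁ t ht

/-- Every infinite word has an image under a nonerasing morphism. -/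
theorem exists_infImage {f : A → List B} (hf : Nonerasing f) (w : ℕ → A) :
    ∃ x, InfImage f w x := by
  have hlen : ∀ n, n ≤ (applyM f (infPrefix w n)).length := fun n => by
    simpa [infPrefix_length] using length_le_length_applyM hf (infPrefix w n)
  refine ⟨fun n => (applyM f (infPrefix w (n + 1)))[n]'(hlen (n + 1)), fun n i hi => ?_⟩
  rw [List.get_eq_getElem]
  rcases le_total n (i + 1) with h | h
  · exact (applyM_prefix f (infPrefix_prefix w h)).getElem hi
  · exact ((applyM_prefix f (infPrefix_prefix w h)).getElem (hlen (i + 1))).symm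

theorem InfImage.comp {h : A → List B} {g : B → List C} {w : ℕ → A} {x : ℕ → B} {y : ℕ → C}
    (hx : InfImage h w x) (hy : InfImage g x y) : InfImage (fun a => applyM g (h a)) w y := by
  intro n
  rw [← applyM_applyM, isPrefixI_iff.mp (hx n)]
  exact hy _

end WordBasics

section PeriodicWords

variable {A B : Type*}

/-- The periodic infinite word `u u u ⋯`; the letter `d` is only used when `u` is empty. -/
def periodicWord (d : B) (u : List B) (n : ℕ) : B := u.getD (n % u.length) d

theorem periodicWord_of_lt (d : B) (u : List B) {n : ℕ} (h : n < u.length) :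
    periodicWord d u n = u[n] := by
  simp [periodicWord, Nat.mod_eq_of_lt h, h]

theorem periodicWord_add_length (d : B) (u : List B) (n : ℕ) :
    periodicWord d u (n + u.length) = periodicWord d u n := by
  simp [periodicWord]

theorem periodicWord_add_mul (d : B) (u : List B) (n k : ℕ) :
    periodicWord d u (n + k * u.length) = periodicWord d u n := by
  simp [periodicWord]

theorem periodicWord_rotate (d : B) (u v : List B) (n : ℕ) :
    periodicWord d (u ++ v) (n + u.length) = periodicWord d (v ++ u) n := by
  rcases eq_or_ne (u ++ v) [] with h | h
  · obtain ⟨rfl, rfl⟩ := List.append_eq_nil_iff.mp h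
    rfl
  have hpos : 0 < u.length + v.length := by
    rw [← List.length_append]; exact List.length_pos_iff.mpr h
  have hr : n % (u.length + v.length) < u.length + v.length := Nat.mod_lt _ hpos
  simp only [periodicWord, List.length_append]
  rw [Nat.add_comm v.length, Nat.add_mod, ← Nat.mod_add_mod]
  generalize n % (u.length + v.length) = r at hr
  rw [Nat.add_mod_mod, Nat.mod_add_mod] 
  rcases lt_or_ge r v.length with hv | hv
  · rw [Nat.mod_eq_of_lt (by omega : r + u.length < _)]
    simp [List.getD_eq_getElem?_getD, List.getElem?_append, hv]
  · have : (r + u.length) % (u.length + v.length) = r - v.length := by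
      rw [Nat.mod_eq_sub_mod (by omega), Nat.mod_eq_of_lt (by omega)]
      omega
    rw [this]
    have h₁ : ¬ r < v.length := by omega
    have h₂ : r - v.length < u.length := by omega
    simp [List.getD_eq_getElem?_getD, List.getElem?_append, h₁, h₂]

theorem listPow_succ (u : List B) (k : ℕ) : listPow u (k + 1) = u ++ listPow u k := by
  simp [listPow, List.replicate_succ]

theorem listPow_length (u : List B) (k : ℕ) : (listPow u k).length = k * u.length := by
  simp [listPow]

theorem listPow_mul (u : List B) (k l : ℕ) : listPow (listPow u k) l = listPow u (k * l) := by
  induction l with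
  | zero => simp [listPow]
  | succ l ih =>
    rw [listPow_succ, ih, Nat.mul_succ, Nat.add_comm]
    rw [listPow, listPow, listPow, ← List.flatten_append, List.replicate_append_replicate]

theorem applyM_listPow (f : A → List B) (u : List A) (k : ℕ) :
    applyM f (listPow u k) = listPow (applyM f u) k := by
  induction k with
  | zero => rfl
  | succ k ih => rw [listPow_succ, applyM_append, ih, listPow_succ]

theorem append_isPrefixI_periodicWord {d : B} {u v : List B}
    (h : IsPrefixI v (periodicWord d u)) : IsPrefixI (u ++ v) (periodicWord d u) := by
  intro i hi
  rw [List.get_eq_getElem]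
  rcases lt_or_ge i u.length with hu | hu
  · rw [List.getElem_append_left hu, periodicWord_of_lt d u hu]
  · obtain ⟨j, rfl⟩ := Nat.exists_eq_add_of_le' hu
    have := h j (by rw [List.length_append] at hi; omega)
    rw [List.getElem_append_right hu, periodicWord_add_length, ← this]
    simp

theorem listPow_isPrefixI (d : B) (u : List B) (k : ℕ) :
    IsPrefixI (listPow u k) (periodicWord d u) := by
  induction k with
  | zero => intro i hi; simp [listPow] at hi
  | succ k ih =>
    rw [listPow_succ]
    exact append_isPrefixI_periodicWord ih

theorem infImage_periodicWord (f : A → List B) (d : A) (d' : B) {u : List A} (hu : u ≠ []) :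
    InfImage f (periodicWord d u) (periodicWord d' (applyM f u)) := by
  intro n
  have h₁ : infPrefix (periodicWord d u) n <+: listPow u n := by
    refine (infPrefix_isPrefixI _ _).prefix_of_length_le (listPow_isPrefixI d u n) ?_
    rw [infPrefix_length, listPow_length]
    exact Nat.le_mul_of_pos_right _ (List.length_pos_iff.mpr hu)
  refine IsPrefixI.of_prefix (listPow_isPrefixI d' _ n) ?_
  rw [← applyM_listPow]
  exact applyM_prefix f h₁

end PeriodicWords

section Commutation

variable {B : Type*}

theorem listPow_one (u : List B) : listPow u 1 = u := by simp [listPow]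

theorem listPow_add (u : List B) (k l : ℕ) : listPow u (k + l) = listPow u k ++ listPow u l := by
  rw [listPow, listPow, listPow, ← List.flatten_append, List.replicate_append_replicate]

theorem isPrefixI_periodicWord (d : B) (u : List B) : IsPrefixI u (periodicWord d u) := by
  simpa [listPow_one] using listPow_isPrefixI d u 1

/-- Commuting nonempty words are powers of a common word. -/
theorem exists_listPow_of_append_comm : ∀ (n : ℕ) (u v : List B), u.length + v.length = n →
    u ≠ [] → v ≠ [] → u ++ v = v ++ u →
    ∃ (z : List B) (p q : ℕ), 0 < p ∧ 0 < q ∧ u = listPow z p ∧ v = listPow z q := by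
  intro n
  induction n using Nat.strong_induction_on with
  | _ n ih =>
    have main : ∀ u v : List B, u.length + v.length = n → u.length ≤ v.length →
        u ≠ [] → v ≠ [] → u ++ v = v ++ u →
        ∃ (z : List B) (p q : ℕ), 0 < p ∧ 0 < q ∧ u = listPow z p ∧ v = listPow z q := by
      intro u v hn hle hu hv h
      have hpre : u <+: v :=
        List.prefix_of_prefix_length_le (h ▸ List.prefix_append u v) (List.prefix_append v u) hle
      obtain ⟨s, rfl⟩ := hpre
      rcases eq_or_ne s [] with rfl | hs
      · exact ⟨u, 1, 1, by simp, by simp, (listPow_one u).symm, by simp [listPow_one]⟩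
      have hus : u ++ s = s ++ u := by
        rw [List.append_assoc] at h
        exact List.append_cancel_left h
      have hupos := List.length_pos_iff.mpr hu
      obtain ⟨z, p, q, hp, hq, h₁, h₂⟩ :=
        ih _ (by rw [← hn, List.length_append]; omega) u s rfl hu hs hus
      refine ⟨z, p, p + q, hp, by omega, h₁, ?_⟩
      rw [listPow_add, ← h₁, ← h₂]
    intro u v hn hu hv h
    rcases le_total u.length v.length with hle | hle
    · exact main u v hn hle hu hv h
    · obtain ⟨z, p, q, hp, hq, h₁, h₂⟩ := main v u (by omega) hle hv hu h.symm
      exact ⟨z, q, p, hq, hp, h₂, h₁⟩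

theorem periodicWord_listPow (d : B) (u : List B) {k : ℕ} (hk : 0 < k) :
    periodicWord d (listPow u k) = periodicWord d u := by
  rcases eq_or_ne u [] with rfl | hu
  · have : listPow ([] : List B) k = [] := by simp [listPow]
    rw [this]
  funext n
  have hpos := List.length_pos_iff.mpr hu
  have hlen : n < (listPow u (k * (n + 1))).length := by
    rw [listPow_length]
    calc n < n + 1 := Nat.lt_succ_self n
      _ ≤ k * (n + 1) := Nat.le_mul_of_pos_left _ hk
      _ ≤ _ := Nat.le_mul_of_pos_right _ hpos
  have h₁ := listPow_isPrefixI d u (k * (n + 1)) n hlen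
  have h₂ := listPow_isPrefixI d (listPow u k) (n + 1)
  rw [listPow_mul] at h₂
  rw [← h₁, ← h₂ n hlen]

theorem append_comm_of_periodicWord_eq {d : B} {u v : List B}
    (h : periodicWord d u = periodicWord d v) : u ++ v = v ++ u := by
  have h₁ : IsPrefixI (u ++ v) (periodicWord d u) :=
    append_isPrefixI_periodicWord (h ▸ isPrefixI_periodicWord d v)
  have h₂ : IsPrefixI (v ++ u) (periodicWord d u) := by
    have := append_isPrefixI_periodicWord (h.symm ▸ isPrefixI_periodicWord d u :
      IsPrefixI u (periodicWord d v))
    rwa [h]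
  exact (h₁.prefix_of_length_le h₂ (by simp [Nat.add_comm])).eq_of_length (by simp [Nat.add_comm])

theorem periodicWord_eq_of_append_comm (d : B) {u v : List B} (hu : u ≠ []) (hv : v ≠ [])
    (h : u ++ v = v ++ u) : periodicWord d u = periodicWord d v := by
  obtain ⟨z, p, q, hp, hq, rfl, rfl⟩ := exists_listPow_of_append_comm _ u v rfl hu hv h
  rw [periodicWord_listPow d z hp, periodicWord_listPow d z hq]

theorem listPow_ne_nil_left {u : List B} {k : ℕ} (h : listPow u k ≠ []) : u ≠ [] := by
  rintro rfl
  exact h (by simp [listPow])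

/-- Commuting nonempty words have the same primitive root. -/
theorem exists_isPrimRoot_of_append_comm {u v : List B} (hu : u ≠ []) (hv : v ≠ [])
    (h : u ++ v = v ++ u) : ∃ r, IsPrimRoot r u ∧ IsPrimRoot r v := by
  classical
  obtain ⟨d, -⟩ := List.exists_mem_of_ne_nil u hu
  have hex : ∃ n : ℕ, ∃ (r : List B) (k : ℕ), r.length = n ∧ 0 < k ∧ u = listPow r k :=
    ⟨_, u, 1, rfl, one_pos, (listPow_one u).symm⟩
  obtain ⟨r, k, hrn, hk, hur⟩ := Nat.find_spec hex
  have hmin : ∀ (s : List B) (l : ℕ), 0 < l → u = listPow s l → r.length ≤ s.length :=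
    fun s l hl hs => hrn ▸ Nat.find_min' hex ⟨s, l, rfl, hl, hs⟩
  have hper : periodicWord d u = periodicWord d v := periodicWord_eq_of_append_comm d hu hv h
  have hr : r ≠ [] := listPow_ne_nil_left (hur ▸ hu)
  have hrper : periodicWord d r = periodicWord d u := by rw [hur, periodicWord_listPow d r hk]
  refine ⟨r, ⟨⟨k, hk, hur⟩, hmin⟩, ?_, ?_⟩
  · obtain ⟨z, p, q, hp, hq, hrz, hvz⟩ := exists_listPow_of_append_comm _ r v rfl hr hv
      (append_comm_of_periodicWord_eq (hrper.trans hper))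
    have hz : 0 < z.length := List.length_pos_iff.mpr (listPow_ne_nil_left (hrz ▸ hr))
    have hle := hmin z (p * k) (Nat.mul_pos hp hk) (by rw [hur, ← listPow_mul, ← hrz])
    have hp1 : p = 1 := by
      rw [hrz, listPow_length] at hle
      have : p ≤ 1 := Nat.le_of_mul_le_mul_right (by simpa using hle) hz
      omega
    rw [hp1, listPow_one] at hrz
    exact ⟨q, hq, hrz ▸ hvz⟩
  · intro s m hm hs
    have hs0 : s ≠ [] := listPow_ne_nil_left (hs ▸ hv)
    have hsper : periodicWord d s = periodicWord d u := by
      rw [hper, hs, periodicWord_listPow d s hm]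
    obtain ⟨z, p, q, hp, hq, hsz, huz⟩ := exists_listPow_of_append_comm _ s u rfl hs0 hu
      (append_comm_of_periodicWord_eq hsper)
    refine (hmin z q hq huz).trans ?_
    rw [hsz, listPow_length]
    exact Nat.le_mul_of_pos_left _ hp

end Commutation

section BasicLSP

variable {A B : Type*}

/-- Images of letters under a bLSP morphism: they start with the letter `α`, which occurs
nowhere else in them, and end with the letter they are the image of. -/
theorem IsBLSP.exists_root {g : B → List B} (hg : IsBLSP g) :
    ∃ α : B, ∀ β, (∃ s, g β = α :: s ∧ α ∉ s) ∧ ∃ t, g β = t ++ [β] := by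
  obtain ⟨α, hα, h⟩ := hg
  refine ⟨α, fun β => ⟨?_, ?_⟩⟩
  · induction hn : (g β).length using Nat.strong_induction_on generalizing β with
    | _ n ih =>
      rcases eq_or_ne β α with rfl | hβ
      · exact ⟨[], hα, by simp⟩
      obtain ⟨γ, hγ⟩ := h β hβ
      obtain ⟨s, hs, hαs⟩ := ih (g γ).length (by rw [← hn, hγ]; simp) γ rfl
      exact ⟨s ++ [β], by rw [hγ, hs]; simp, by simp [hαs, hβ.symm]⟩
  · rcases eq_or_ne β α with rfl | hβ
    · exact ⟨[], by simp [hα]⟩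
    obtain ⟨γ, hγ⟩ := h β hβ
    exact ⟨g γ, hγ⟩

theorem IsBLSP.nonerasing {g : B → List B} (hg : IsBLSP g) : Nonerasing g := by
  obtain ⟨α, h⟩ := hg.exists_root
  intro β hβ
  obtain ⟨s, hs, -⟩ := (h β).1
  simp [hβ] at hs

/-- Decoding: a bLSP image followed by the root letter determines its preimage. -/
theorem prefix_of_applyM_prefix {g : B → List B} {α : B}
    (hα : ∀ β, (∃ s, g β = α :: s ∧ α ∉ s) ∧ ∃ t, g β = t ++ [β]) :
    ∀ {u v : List B}, applyM g u ++ [α] <+: applyM g v → u <+: v := by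
  have starts : ∀ u : List B, ∃ s, applyM g u ++ [α] = α :: s := by
    intro u
    cases u with
    | nil => exact ⟨[], rfl⟩
    | cons c u =>
      obtain ⟨s, hs, -⟩ := (hα c).1
      exact ⟨s ++ applyM g u ++ [α], by rw [applyM_cons, hs]; simp⟩
  intro u
  induction u with
  | nil => intro v _; exact List.nil_prefix
  | cons c u ih =>
    intro v h
    cases v with
    | nil =>
      have := h.length_le
      simp [applyM_nil] at this
    | cons d v =>
      obtain ⟨s, hs, hαs⟩ := (hα c).1
      obtain ⟨t, ht, hαt⟩ := (hα d).1
      obtain ⟨r, hr⟩ := starts u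
      have h' := h
      rw [applyM_cons, applyM_cons, List.append_assoc, hr, hs, ht, List.cons_append,
        List.cons_append, List.cons_prefix_cons] at h'
      have h'' := h'.2
      have hst : s = t := by
        have h₁ : s ++ [α] <+: t ++ applyM g v :=
          (List.prefix_append (s ++ [α]) r).trans (by simpa using h'')
        have h₂ : t <+: t ++ applyM g v := List.prefix_append _ _
        rcases lt_or_ge s.length t.length with hlt | hge
        · have := List.prefix_of_prefix_length_le h₁ h₂ (by simpa using hlt)
          exact absurd (this.subset (by simp)) hαt
        · have hts : t <+: s := List.prefix_of_prefix_length_le h₂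
            ((List.prefix_append s [α]).trans h₁) hge
          obtain ⟨z, rfl⟩ := hts
          cases z with
          | nil => simp
          | cons y z =>
            exfalso
            rw [List.append_assoc, List.prefix_append_right_inj] at h₁
            cases v with
            | nil => simpa [applyM_nil] using h₁.length_le
            | cons e v =>
              obtain ⟨q, hq, -⟩ := (hα e).1
              rw [applyM_cons, hq, List.cons_append, List.cons_append,
                List.cons_prefix_cons] at h₁
              exact hαs (by simp [h₁.1])
      have hcd : c = d := by
        obtain ⟨p, hp⟩ := (hα c).2
        obtain ⟨q, hq⟩ := (hα d).2
        have : p ++ [c] = q ++ [d] := by rw [← hp, ← hq, hs, ht, hst]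
        simpa using (List.append_inj' this rfl).2
      subst hcd
      rw [applyM_cons, applyM_cons, List.append_assoc, List.prefix_append_right_inj] at h
      exact List.cons_prefix_cons.mpr ⟨rfl, ih h⟩

/-- A preimage of an LSP word under a bLSP morphism is LSP. -/
theorem IsBLSP.isLSP_of_infImage {g : B → List B} (hg : IsBLSP g) {w x : ℕ → B}
    (hx : InfImage g w x) (hlsp : IsLSP x) : IsLSP w := by
  obtain ⟨α, hα⟩ := hg.exists_root
  rintro u ⟨a, b, hab, ha, hb⟩
  have key : ∀ c, IsFactorI (c :: u) w → IsFactorI (c :: (applyM g u ++ [α])) x := by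
    rintro c ⟨k, hk⟩
    have hcu : c :: u = infPrefix (fun i => w (k + i)) (c :: u).length :=
      isPrefixI_iff.mp hk
    obtain ⟨p, hp⟩ := (hα c).2
    obtain ⟨q, hq, -⟩ := (hα (w (k + (c :: u).length))).1
    have hpre := hx (k + (c :: u).length + 1)
    have hlast : infPrefix (fun i => w (k + (c :: u).length + i)) 1 =
        [w (k + (c :: u).length)] := by simp [infPrefix]
    rw [infPrefix_add, infPrefix_add, ← hcu, hlast, applyM_append, applyM_append, applyM_cons,
      hp, applyM_singleton, hq] at hpre
    refine IsPrefixI.isFactorI (s := applyM g (infPrefix w k) ++ p) (t := q) ?_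
    simpa using hpre
  have hU := hlsp _ ⟨a, b, hab, key a ha, key b hb⟩
  set n := (applyM g u ++ [α]).length with hn
  have hle : n ≤ (applyM g (infPrefix w n)).length := by
    simpa [infPrefix_length] using length_le_length_applyM hg.nonerasing (infPrefix w n)
  have := prefix_of_applyM_prefix hα (hU.prefix_of_length_le (hx n) hle)
  exact (infPrefix_isPrefixI w n).of_prefix this

theorem IsBLSP.preservesLSP_of_comp {g : B → List B} (hg : IsBLSP g) {h : A → List B}
    (hpres : PreservesLSP fun a => applyM g (h a)) : PreservesLSP h := by
  intro w x hw hx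
  obtain ⟨y, hy⟩ := exists_infImage hg.nonerasing x
  exact hg.isLSP_of_infImage hy (hpres w y hw (hx.comp hy))

/-- The bLSP morphism attached to a well-founded predecessor function. -/
theorem exists_isBLSP_of_pred (α : B) (pred : B → B)
    (hwf : WellFounded fun γ β => β ≠ α ∧ pred β = γ) :
    ∃ g : B → List B, g α = [α] ∧ ∀ β, β ≠ α → g β = g (pred β) ++ [β] := by
  classical
  let g : B → List B := hwf.fix fun β rec =>
    if h : β = α then [α] else rec (pred β) ⟨h, rfl⟩ ++ [β]
  have hgeq : ∀ β, g β = if β = α then [α] else g (pred β) ++ [β] := by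
    intro β
    change hwf.fix _ β = _
    rw [hwf.fix_eq]
    split_ifs <;> rfl
  exact ⟨g, by rw [hgeq, if_pos rfl], fun β hβ => by rw [hgeq, if_neg hβ]⟩

/-- If every letter other than `α` has the prescribed predecessor in a word that starts with
`α`, then the word is a product of images of letters. -/
theorem exists_applyM_eq {α : B} {pred : B → B} {g : B → List B} (hgα : g α = [α])
    (hg : ∀ β, β ≠ α → g β = g (pred β) ++ [β]) (s : List B)
    (hs : List.IsChain (fun x y => y ≠ α → pred y = x) (α :: s)) :
    ∃ v, applyM g v = α :: s := by
  suffices H : ∀ s : List B, List.IsChain (fun x y => y ≠ α → pred y = x) (α :: s) →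
      ∃ v c, applyM g v ++ g c = α :: s ∧ (α :: s).getLast? = some c by
    obtain ⟨v, c, h, -⟩ := H s hs
    exact ⟨v ++ [c], by rw [applyM_append, applyM_singleton, h]⟩
  intro s
  induction s using List.reverseRecOn with
  | nil => intro _; exact ⟨[], α, by simp [applyM_nil, hgα], rfl⟩
  | append_singleton s y ih =>
    intro hch
    rw [← List.cons_append, List.isChain_append] at hch
    obtain ⟨v, c, h, hc⟩ := ih hch.1
    rcases eq_or_ne y α with rfl | hy
    · exact ⟨v ++ [c], y, by rw [applyM_append, applyM_singleton, h, hgα]; rfl,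
        by rw [← List.cons_append]; exact List.getLast?_concat ..⟩
    · have := hch.2.2 c hc y (by simp) hy
      refine ⟨v, y, ?_, by rw [← List.cons_append]; exact List.getLast?_concat ..⟩
      rw [hg y hy, this, ← List.append_assoc, h]
      rfl

end BasicLSP

section PeriodicLSP

variable {A B : Type*}

theorem periodicWord_eq_getElem (d : B) {u : List B} (hu : u ≠ []) (n : ℕ) :
    periodicWord d u n = u[n % u.length]'(Nat.mod_lt _ (List.length_pos_iff.mpr hu)) := by
  simp [periodicWord, Nat.mod_lt n (List.length_pos_iff.mpr hu)]

theorem periodicWord_eq_of_mod_eq (d : B) (u : List B) {m n : ℕ}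
    (h : m % u.length = n % u.length) : periodicWord d u m = periodicWord d u n := by
  rw [periodicWord, periodicWord, h]

theorem isLSP_periodicWord_of_nodup (d : A) {u : List A} (hu : u.Nodup) :
    IsLSP (periodicWord d u) := by
  rcases eq_or_ne u [] with rfl | hne
  · exact isLSP_iff.mpr fun i j n hij => absurd rfl hij
  refine isLSP_iff.mpr fun i j n hij h t ht => absurd ?_ hij
  have h0 := h 0 (by omega)
  rw [periodicWord_eq_getElem d hne, periodicWord_eq_getElem d hne, hu.getElem_inj_iff] at h0
  exact periodicWord_eq_of_mod_eq d u (Nat.ModEq.add_right_cancel' 1 h0)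

/-- Doubling the first letter of the period of a periodic word with distinct letters keeps
the LSP property. -/
theorem isLSP_periodicWord_cons_self (d : A) {a b : A} {s : List A}
    (hs : (a :: b :: s).Nodup) : IsLSP (periodicWord d (a :: a :: b :: s)) := by
  set u := a :: a :: b :: s with hu
  have hne : u ≠ [] := by simp [hu]
  have hlen : u.length = s.length + 3 := by simp [hu]
  have hab : a ≠ b := by
    rintro rfl
    simp at hs
  have hinj : ∀ (p q : ℕ) (hp : p < u.length) (hq : q < u.length), u[p] = u[q] → p < q →
      p = 0 ∧ q = 1 := by
    intro p q hp hq h hlt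
    obtain ⟨q, rfl⟩ := Nat.exists_eq_succ_of_ne_zero (by omega : q ≠ 0)
    have hq' : q < (a :: b :: s).length := by simp [hlen] at hq ⊢; omega
    have e₁ : u[q + 1] = (a :: b :: s)[q] := rfl
    cases p with
    | zero =>
      have e₂ : u[0] = (a :: b :: s)[0] := rfl
      rw [e₁, e₂, hs.getElem_inj_iff] at h
      omega
    | succ p =>
      have e₂ : u[p + 1] = (a :: b :: s)[p]'(by omega) := rfl
      rw [e₁, e₂, hs.getElem_inj_iff] at h
      omega
  have hval : ∀ m, (m % u.length = 0 ∨ m % u.length = 1) → periodicWord d u m = a := by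
    intro m hm
    rcases hm with hm | hm
    · rw [periodicWord_eq_of_mod_eq d u (n := 0) (by simpa using hm)]
      rfl
    · rw [periodicWord_eq_of_mod_eq d u (n := 1)
        (by rw [hm, Nat.mod_eq_of_lt]; omega), periodicWord_of_lt d u (by omega)]
      rfl
  have hval2 : ∀ m, m % u.length = 1 → periodicWord d u (m + 1) = b := by
    intro m hm
    rw [periodicWord_eq_of_mod_eq d u (m := m + 1) (n := 2)
      (by rw [Nat.add_mod, hm, hlen]; simp),
      periodicWord_of_lt d u (by omega)]
    rfl
  have hval1 : ∀ m, m % u.length = 0 → periodicWord d u (m + 1) = a := by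
    intro m hm
    refine hval _ (Or.inr ?_)
    rw [Nat.add_mod, hm, hlen]
    simp
  have main : ∀ m m', periodicWord d u m = periodicWord d u m' → m % u.length < m' % u.length →
      periodicWord d u m = a ∧ periodicWord d u (m + 1) ≠ periodicWord d u (m' + 1) := by
    intro m m' h hlt
    rw [periodicWord_eq_getElem d hne, periodicWord_eq_getElem d hne] at h
    obtain ⟨h₁, h₂⟩ := hinj _ _ _ _ h hlt
    exact ⟨hval m (Or.inl h₁), by rwa [hval1 m h₁, hval2 m' h₂]⟩
  refine isLSP_iff.mpr fun i j n hij h t ht => ?_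
  have h0 := h 0 (by omega)
  have hcase : periodicWord d u (i + 1) = a ∧
      periodicWord d u (i + 1 + 1) ≠ periodicWord d u (j + 1 + 1) := by
    rcases lt_trichotomy ((i + 1) % u.length) ((j + 1) % u.length) with hlt | heq | hlt
    · exact main _ _ h0 hlt
    · exact absurd (periodicWord_eq_of_mod_eq d u (Nat.ModEq.add_right_cancel' 1 heq)) hij
    · obtain ⟨h₁, h₂⟩ := main _ _ h0.symm hlt
      exact ⟨h0.trans h₁, h₂.symm⟩
  have ht0 : t = 0 := by
    by_contra hne0
    exact hcase.2 (h 1 (by omega))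
  subst ht0
  rw [Nat.add_zero, hcase.1]
  exact hval 0 (Or.inl (by simp))

end PeriodicLSP

section Factorization

variable {A B : Type*}

/-- A nonerasing LSP-preserving morphism under which two letters have images with different
first letters has no repeated letter in the concatenation of the images. -/
theorem PreservesLSP.nodup_applyM {f : A → List B} (hne : Nonerasing f) (hpres : PreservesLSP f)
    {a b : A} {s : List A} (hs : (a :: b :: s).Nodup)
    (hhead : (f a).head (hne a) ≠ (f b).head (hne b)) :
    (applyM f (a :: b :: s)).Nodup := by
  set F := applyM f (a :: b :: s) with hF
  set d := (f a).head (hne a) with hd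
  set X := periodicWord d F with hX
  set e := f a with he
  set G := applyM f (b :: s) with hG
  have hFe : F = e ++ G := applyM_cons ..
  have hepos : 0 < e.length := List.length_pos_iff.mpr (hne a)
  have hGpos : 0 < G.length := by
    rw [hG, applyM_cons, List.length_append]
    have := List.length_pos_iff.mpr (hne b)
    omega
  have hNlen : F.length = e.length + G.length := by rw [hFe, List.length_append]
  have hXlsp : IsLSP X :=
    hpres _ _ (isLSP_periodicWord_of_nodup a hs) (infImage_periodicWord f a d (by simp))
  have hX'lsp : IsLSP (periodicWord d (G ++ e)) := by
    have hs' : (b :: s ++ [a]).Nodup := by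
      rw [List.nodup_append_comm]
      exact hs
    have := hpres _ _ (isLSP_periodicWord_of_nodup a hs')
      (infImage_periodicWord f a d (by simp))
    rwa [applyM_append, applyM_singleton] at this
  have hrot : ∀ n, X (n + e.length) = periodicWord d (G ++ e) n := by
    intro n
    rw [hX, hFe, periodicWord_rotate]
  have hX0 : X 0 = d := by
    rw [hX, periodicWord_of_lt d F (by omega)]
    simp only [hFe, List.getElem_append_left hepos, hd, List.head_eq_getElem]
    rfl
  have hXe : X e.length = (f b).head (hne b) := by
    have := hrot 0
    have hb := List.length_pos_iff.mpr (hne b)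
    rw [Nat.zero_add] at this
    rw [this, periodicWord_of_lt _ _ (by rw [List.length_append]; omega),
      List.getElem_append_left hGpos]
    simp only [hG, applyM_cons, List.getElem_append_left hb, List.head_eq_getElem]
  have hperN : ∀ n, X (n + F.length) = X n := periodicWord_add_length d F
  -- no letter is left special in `X`
  have hpred : ∀ i j, X (i + 1) = X (j + 1) → X i = X j := by
    intro i j h
    by_contra hij
    have h₁ := isLSP_iff.mp hXlsp i j 1 hij (by
      intro t ht
      obtain rfl : t = 0 := by omega
      exact h) 0 one_pos
    have shift : ∀ k, periodicWord d (G ++ e) (k + G.length) = X k := by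
      intro k
      rw [← hrot, Nat.add_assoc, Nat.add_comm G.length, ← hNlen, hperN]
    have h₂ := isLSP_iff.mp hX'lsp (i + G.length) (j + G.length) 1 (by rwa [shift, shift]) (by
      intro t ht
      obtain rfl : t = 0 := by omega
      simp only [Nat.add_zero]
      rw [Nat.add_right_comm, Nat.add_right_comm j, shift, shift]
      exact h) 0 one_pos
    rw [Nat.add_zero, Nat.add_right_comm, shift, ← hrot, Nat.zero_add, hXe] at h₂
    rw [Nat.add_zero, hX0] at h₁
    exact hhead (h₁.trans h₂.symm)
  have hback : ∀ k i j, X (i + k) = X (j + k) → X i = X j := by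
    intro k
    induction k with
    | zero => exact fun i j h => h
    | succ k ih => exact fun i j h => ih i j (hpred (i + k) (j + k) h)
  have hforth : ∀ k i j, X i = X j → X (i + k) = X (j + k) := by
    intro k i j h
    have hk : k ≤ k * F.length := Nat.le_mul_of_pos_right _ (by omega)
    refine hback (k * F.length - k) _ _ ?_
    rw [Nat.add_assoc, Nat.add_assoc, Nat.add_sub_cancel' hk]
    exact (periodicWord_add_mul d F i k).trans (h.trans (periodicWord_add_mul d F j k).symm)
  rw [List.nodup_iff_injective_getElem]
  by_contra hnot
  -- a repeated letter yields a period `c` shorter than `F`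
  obtain ⟨c, hc0, hcN, hper⟩ : ∃ c, 0 < c ∧ c < F.length ∧ ∀ n, X (n + c) = X n := by
    have aux : ∀ i j, i < j → j < F.length → X i = X j →
        ∃ c, 0 < c ∧ c < F.length ∧ ∀ n, X (n + c) = X n := by
      intro i j hij hj h
      refine ⟨j - i, by omega, by omega, fun n => ?_⟩
      have h0 : X 0 = X (j - i) := hback i _ _ (by
        rw [Nat.zero_add, Nat.sub_add_cancel hij.le]; exact h)
      have := hforth n _ _ h0
      rw [Nat.zero_add] at this
      rw [this, Nat.add_comm]
    simp only [Function.Injective, not_forall] at hnot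
    obtain ⟨i, j, hij, hne'⟩ := hnot
    have hXij : X i = X j := by
      rw [hX, periodicWord_of_lt d F i.2, periodicWord_of_lt d F j.2]
      exact hij
    rcases lt_or_gt_of_ne (fun h => hne' (Fin.ext h) : (i : ℕ) ≠ j) with h | h
    · exact aux i j h j.2 hXij
    · exact aux j i h i.2 hXij.symm
  -- in the image of the word where `a` is doubled, `f a` followed by the first letter of `f b`
  -- is left special
  set Y := periodicWord d (e ++ F) with hY
  have hYlsp : IsLSP Y := by
    have := hpres _ _ (isLSP_periodicWord_cons_self a hs)
      (infImage_periodicWord f a d (by simp))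
    rwa [applyM_cons] at this
  have hYX : ∀ t, t < F.length + e.length → Y (e.length + t) = X t := by
    intro t ht
    rw [Nat.add_comm, hY, periodicWord_rotate, periodicWord_of_lt _ _ (by simpa using ht)]
    rcases lt_or_ge t F.length with h | h
    · rw [List.getElem_append_left h, hX, periodicWord_of_lt d F h]
    · rw [List.getElem_append_right h]
      obtain ⟨r, rfl⟩ := Nat.exists_eq_add_of_le' h
      rw [hperN, hX, periodicWord_of_lt d F (by omega)]
      simp only [hFe, Nat.add_sub_cancel]
      rw [List.getElem_append_left (by omega)]
  have hYe : Y (e.length - 1) = X (e.length - 1) := by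
    rw [hY, hX, periodicWord_of_lt _ _ (by rw [List.length_append]; omega),
      periodicWord_of_lt _ _ (by omega), List.getElem_append_left (by omega)]
    simp only [hFe]
    rw [List.getElem_append_left (by omega)]
  have hlast : X (e.length - 1) ≠ X (F.length - 1) := by
    intro h
    have := hforth 1 _ _ h
    rw [Nat.sub_add_cancel (by omega), Nat.sub_add_cancel (by omega)] at this
    have h0 := hperN 0
    rw [Nat.zero_add] at h0
    rw [h0, hXe, hX0] at this
    exact hhead this.symm
  have hsecond : Y (e.length + c - 1) = X (F.length - 1) := by
    rw [Nat.add_sub_assoc (by omega), hYX _ (by omega), ← hper (F.length - 1), ← hperN (c - 1)]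
    congr 1
    omega
  have hfin := isLSP_iff.mp hYlsp (e.length - 1) (e.length + c - 1) (e.length + 1)
    (by rwa [hYe, hsecond]) (by
      intro t ht
      rw [Nat.sub_add_cancel (by omega), Nat.sub_add_cancel (by omega), hYX _ (by omega),
        Nat.add_assoc, hYX _ (by omega), Nat.add_comm c, hper]) e.length (by omega)
  rw [Nat.sub_add_cancel (by omega), hYX _ (by omega), hXe] at hfin
  have h0 := hYX 0 (by omega)
  rw [Nat.add_zero, hX0] at h0
  exact hhead (h0.symm.trans hfin)

end Factorization

section Desubstitution

variable {A B : Type*}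

/-- A nonerasing LSP-preserving morphism whose images of letters all start with `α` factors
through a bLSP morphism. -/
theorem PreservesLSP.exists_isBLSP_comp {f : A → List B} (hne : Nonerasing f)
    (hpres : PreservesLSP f) {α : B} (hα : ∀ a, (f a).head (hne a) = α) {s : List A}
    (hs : s.Nodup) (hmem : ∀ a, a ∈ s) (hs0 : s ≠ []) :
    ∃ (g : B → List B) (h : A → List B), IsBLSP g ∧ (∀ a, f a = applyM g (h a)) := by
  classical
  have hcons : ∀ a, ∃ t, f a = α :: t := fun a =>
    ⟨(f a).tail, by rw [← hα a, List.cons_head_tail]⟩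
  set F := applyM f s with hF
  set X := periodicWord α F with hX
  obtain ⟨a₀, s', rfl⟩ := List.exists_cons_of_ne_nil hs0
  have hX0 : X 0 = α := by
    obtain ⟨t, ht⟩ := hcons a₀
    rw [hX, hF, applyM_cons, ht]
    rfl
  have hXlsp : IsLSP X :=
    hpres _ _ (isLSP_periodicWord_of_nodup a₀ hs) (infImage_periodicWord f a₀ α hs0)
  let pred : B → B := fun β => if h : ∃ i, X (i + 1) = β then X h.choose else α
  have hpred : ∀ i, X (i + 1) ≠ α → pred (X (i + 1)) = X i := by
    intro i hi
    have hex : ∃ j, X (j + 1) = X (i + 1) := ⟨i, rfl⟩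
    have hval : pred (X (i + 1)) = X hex.choose := dif_pos hex
    rw [hval]
    by_contra hij
    refine hi ?_
    have := isLSP_iff.mp hXlsp i hex.choose 1 (Ne.symm hij) (by
      intro t ht
      obtain rfl : t = 0 := by omega
      exact hex.choose_spec.symm) 0 one_pos
    exact this.symm.trans hX0
  have haccX : ∀ i, Acc (fun γ β => β ≠ α ∧ pred β = γ) (X i) := by
    intro i
    induction i with
    | zero => exact Acc.intro _ fun γ hγ => absurd hX0 hγ.1
    | succ i ih =>
      refine Acc.intro _ ?_
      rintro γ ⟨h₁, rfl⟩
      rw [hpred i h₁]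
      exact ih
  have hwf : WellFounded fun γ β => β ≠ α ∧ pred β = γ := by
    refine ⟨fun β => ?_⟩
    by_cases hex : ∃ i, X (i + 1) = β
    · obtain ⟨i, rfl⟩ := hex
      exact haccX (i + 1)
    · refine Acc.intro _ ?_
      rintro γ ⟨-, rfl⟩
      have hval : pred β = α := dif_neg hex
      rw [hval]
      exact hX0 ▸ haccX 0
  obtain ⟨g, hgα, hg⟩ := exists_isBLSP_of_pred α pred hwf
  have hchain : List.IsChain (fun x y => y ≠ α → pred y = x) F := by
    rw [List.isChain_iff_getElem]
    intro i hi hy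
    have h₁ := periodicWord_of_lt α F hi
    have h₂ := periodicWord_of_lt α F (Nat.lt_of_succ_lt hi)
    rw [← h₁] at hy ⊢
    rw [← h₂]
    exact hpred i hy
  have hfac : ∀ a, ∃ v, f a = applyM g v := by
    intro a
    obtain ⟨p, q, hpq⟩ := List.append_of_mem (hmem a)
    have hinf : f a <:+: F := by
      rw [hF, hpq, applyM_append, applyM_cons, ← List.append_assoc]
      exact ⟨_, _, rfl⟩
    obtain ⟨t, ht⟩ := hcons a
    obtain ⟨v, hv⟩ := exists_applyM_eq hgα hg t (ht ▸ hchain.infix hinf)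
    exact ⟨v, ht.trans hv.symm⟩
  choose h hh using hfac
  exact ⟨g, h, ⟨α, hgα, fun β hβ => ⟨pred β, hg β hβ⟩⟩, hh⟩

theorem applyM_eq_replicate {g : B → List B} {α : B}
    (hα : ∀ β, (∃ s, g β = α :: s ∧ α ∉ s) ∧ ∃ t, g β = t ++ [β]) (hg : Nonerasing g) :
    ∀ v : List B, (applyM g v).length ≤ v.length → applyM g v = List.replicate v.length α := by
  intro v
  induction v with
  | nil => intro _; rfl
  | cons c v ih =>
    intro hle
    obtain ⟨s, hs, -⟩ := (hα c).1
    have := length_le_length_applyM hg v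
    rw [applyM_cons, hs] at hle
    simp only [List.cons_append, List.length_cons, List.length_append] at hle
    have hs0 : s = [] := List.length_eq_zero_iff.mp (by omega)
    rw [applyM_cons, hs, ih (by omega), hs0]
    rfl

theorem inU_of_nodup [Fintype A] [DecidableEq B] {f : A → List B} (hne : Nonerasing f)
    {s : List A} (hs : s.Nodup) (hmem : ∀ a, a ∈ s) (hnodup : (applyM f s).Nodup) : InU f := by
  classical
  refine ⟨hne, fun b => ?_⟩
  have huniv : (Finset.univ : Finset A) = s.toFinset := by
    ext a
    simp [hmem a]
  rw [huniv, List.sum_toFinset _ hs]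
  have := List.nodup_iff_count_le_one.mp hnodup b
  rw [applyM, List.count_flatten, List.map_map] at this
  exact this

theorem exists_nodup_cons_cons [Fintype A] {a b : A} (hab : a ≠ b) :
    ∃ s : List A, (a :: b :: s).Nodup ∧ ∀ c, c ∈ a :: b :: s := by
  classical
  refine ⟨((Finset.univ.erase a).erase b).toList, ?_, fun c => ?_⟩
  · simp [hab, Finset.nodup_toList]
  · by_cases h₁ : c = a <;> by_cases h₂ : c = b <;> simp [h₁, h₂]

/-- A nonerasing LSP-preserving morphism under which no two distinct letters have commuting
images is a composition of bLSP morphisms after a morphism of `U`. -/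
theorem PreservesLSP.exists_isBLSP_factorization [Fintype A] [DecidableEq B] [Nontrivial A] :
    ∀ (n : ℕ) (f : A → List B), ∑ a, (f a).length = n → Nonerasing f → PreservesLSP f →
    (∀ a b, a ≠ b → f a ++ f b ≠ f b ++ f a) →
    ∃ (L : List (B → List B)) (ν : A → List B), (∀ g ∈ L, IsBLSP g) ∧ InU ν ∧
      ∀ a, f a = L.foldr (fun g v => applyM g v) (ν a) := by
  intro n
  induction n using Nat.strong_induction_on with
  | _ n ih =>
    intro f hn hne hpres hcomm
    by_cases hhead : ∃ a b, (f a).head (hne a) ≠ (f b).head (hne b)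
    · obtain ⟨a, b, hab⟩ := hhead
      obtain ⟨s, hs, hmem⟩ := exists_nodup_cons_cons (fun h : a = b => hab (by subst h; rfl))
      exact ⟨[], f, by simp, inU_of_nodup hne hs hmem (hpres.nodup_applyM hne hs hab),
        fun a => rfl⟩
    · simp only [ne_eq, not_exists, not_not] at hhead
      obtain ⟨a, b, hab⟩ := exists_pair_ne A
      obtain ⟨s, hs, hmem⟩ := exists_nodup_cons_cons hab
      obtain ⟨g, h, hg, hfh⟩ :=
        hpres.exists_isBLSP_comp hne (fun c => hhead c a) hs hmem (by simp)
      have hh : Nonerasing h := fun c hc => hne c (by rw [hfh, hc, applyM_nil])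
      have hle : ∀ c, (h c).length ≤ (f c).length := fun c => by
        rw [hfh]
        exact length_le_length_applyM hg.nonerasing _
      have hlt : ∃ c, (h c).length < (f c).length := by
        by_contra hnot
        simp only [not_exists, not_lt] at hnot
        obtain ⟨α, hα⟩ := hg.exists_root
        have hrep : ∀ c, f c = List.replicate (h c).length α := fun c => by
          rw [hfh]
          exact applyM_eq_replicate hα hg.nonerasing _ (hfh c ▸ hnot c)
        refine hcomm a b hab ?_
        rw [hrep a, hrep b, List.replicate_append_replicate, List.replicate_append_replicate,
          Nat.add_comm]
      have hsum : ∑ c, (h c).length < n := by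
        rw [← hn]
        obtain ⟨c, hc⟩ := hlt
        exact Finset.sum_lt_sum (fun c _ => hle c) ⟨c, Finset.mem_univ c, hc⟩
      obtain ⟨L, ν, hL, hν, hfac⟩ := ih _ hsum h rfl hh
        (hg.preservesLSP_of_comp (funext hfh ▸ hpres)) (fun c d hcd heq => hcomm c d hcd (by
          rw [hfh, hfh, ← applyM_append, heq, applyM_append]))
      refine ⟨g :: L, ν, ?_, hν, fun c => ?_⟩
      · simpa using ⟨hg, hL⟩
      · rw [hfh, hfac]
        rfl

end Desubstitution

/-- Over an alphabet with at least two letters, a nonerasing LSP-preserving morphism whose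
images of distinct letters have distinct primitive roots factors as `g_1 ∘ ⋯ ∘ g_n ∘ ν`
(`L = [g_1, …, g_n]`) with the `g_i` R-bLSP morphisms and `ν ∈ U`. -/
theorem preserving_factors_RbLSP_U {A B : Type*} [Fintype A] [Fintype B]
    [DecidableEq B] [Nontrivial A] (f : A → List B) (hne : Nonerasing f)
    (hpres : PreservesLSP f)
    (hroot : ∀ a b : A, a ≠ b →
      ¬ ∃ r : List B, IsPrimRoot r (f a) ∧ IsPrimRoot r (f b)) :
    ∃ (L : List (B → List B)) (ν : A → List B),
      (∀ g ∈ L, ∃ D : Set B, IsRBLSPOn D g) ∧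
      CompatChain L ∧
      (∀ (a : A) (y : B), y ∈ ν a → ∀ g ∈ L.getLast?, g y ≠ []) ∧
      InU ν ∧
      (∀ a : A, f a = L.foldr (fun g v => applyM g v) (ν a)) := by
  obtain ⟨L, ν, hL, hν, hfac⟩ := PreservesLSP.exists_isBLSP_factorization _ f rfl hne hpres
    fun a b hab h => hroot a b hab (exists_isPrimRoot_of_append_comm (hne a) (hne b) h)
  refine ⟨L, ν, fun g hg => ⟨Set.univ, ?_, g, hL g hg, fun _ _ => rfl⟩, ?_, ?_, hν, hfac⟩
  · exact fun x => ⟨fun _ => (hL g hg).nonerasing x, fun _ => Set.mem_univ x⟩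
  · exact (List.pairwise_of_forall_mem_list
      fun g hg _ _ _ y _ => (hL g hg).nonerasing y).isChain
  · exact fun _ y _ g hg => (hL g (List.mem_of_getLast? hg)).nonerasing y
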